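/- arXiv:1309.1899 — 2 statements merged into one kernel-verified Lean document; each statement's English description precedes it below -/
import Mathlib

section
/- A general cubic fourfold apolar to a Veronese surface has no nonzero partial derivative of rank ≤ 3. Precisely: there exists a nonzero polynomial function P on the 28-dimensional space of sextic forms in 3 variables such that for every sextic g with P(g) ≠ 0, the cubic form f = s(g) satisfies: for every v ∈ ℂ⁶ ∖ {0}, the quadratic form ∂_v f is nonzero of rank ≥ 4. (Lemma 2.4 of the paper; in particular the divisor D_{V-ap} is not contained in D_{rk3}.) -/
open MvPolynomial

/-- The constant-coefficient differential operator associated with the monomial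
exponent `d`: the composition over `i` of `(∂/∂xᵢ)^(d i)`. -/
noncomputable def monOp {n : ℕ} (d : Fin n →₀ ℕ) :
    Module.End ℂ (MvPolynomial (Fin n) ℂ) :=
  (List.ofFn fun i : Fin n =>
    ((pderiv (R := ℂ) i).toLinearMap : Module.End ℂ (MvPolynomial (Fin n) ℂ)) ^ (d i)).prod

/-- The apolarity action `g ∘ f` : apply `g`, viewed as a constant-coefficient
differential operator, to `f`. -/
noncomputable def apolar {n : ℕ} (g f : MvPolynomial (Fin n) ℂ) :
    MvPolynomial (Fin n) ℂ :=
  ∑ d ∈ g.support, coeff d g • monOp d f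

/-- The apolarity pairing `⟨f, k⟩ := k ∘ f` (its constant term). -/
noncomputable def pairing {n : ℕ} (f k : MvPolynomial (Fin n) ℂ) : ℂ :=
  eval (fun _ => (0 : ℂ)) (apolar k f)

/-- The linear form `Σ vᵢ xᵢ` associated with a vector `v`. -/
noncomputable def linForm {n : ℕ} (v : Fin n → ℂ) : MvPolynomial (Fin n) ℂ :=
  ∑ i, MvPolynomial.C (v i) * X i

/-- The directional partial derivative `∂_v f = Σ vᵢ ∂f/∂xᵢ`. -/
noncomputable def pdir {n : ℕ} (v : Fin n → ℂ) (f : MvPolynomial (Fin n) ℂ) :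
    MvPolynomial (Fin n) ℂ :=
  ∑ i, MvPolynomial.C (v i) * pderiv i f

/-- The Veronese map `ν : ℂ³ → ℂ⁶`. -/
noncomputable def nu (w : Fin 3 → ℂ) : Fin 6 → ℂ :=
  ![w 0 ^ 2, 2 * w 0 * w 1, 2 * w 0 * w 2, w 1 ^ 2, 2 * w 1 * w 2, w 2 ^ 2]

/-- The components of the Veronese map as quadratic forms in `y₀, y₁, y₂`. -/
noncomputable def nuPoly : Fin 6 → MvPolynomial (Fin 3) ℂ :=
  ![X 0 ^ 2, 2 * X 0 * X 1, 2 * X 0 * X 2, X 1 ^ 2, 2 * X 1 * X 2, X 2 ^ 2]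

/-- A quadratic form `q` in 6 variables has rank `≤ r`: there is a symmetric matrix
`M` of rank `≤ r` with `q(x) = xᵀ M x`. -/
def QuadRankLe (q : MvPolynomial (Fin 6) ℂ) (r : ℕ) : Prop :=
  ∃ M : Matrix (Fin 6) (Fin 6) ℂ, M.IsSymm ∧ M.rank ≤ r ∧
    ∀ x : Fin 6 → ℂ, eval x q = ∑ i, ∑ j, M i j * x i * x j

/-- `s` is the linear map carrying a ternary sextic `g` to the cubic `s(g)` in six
variables, characterized by `⟨s(g), k⟩ = ⟨g, m(k)⟩` for all cubic forms `k`, where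
`m(k) = k ∘ ν`. -/
def IsSMap (s : MvPolynomial (Fin 3) ℂ →ₗ[ℂ] MvPolynomial (Fin 6) ℂ) : Prop :=
  (∀ g : MvPolynomial (Fin 3) ℂ, g.IsHomogeneous 6 → (s g).IsHomogeneous 3) ∧
  ∀ g : MvPolynomial (Fin 3) ℂ, ∀ k : MvPolynomial (Fin 6) ℂ,
    g.IsHomogeneous 6 → k.IsHomogeneous 3 →
      pairing (s g) k = pairing g (aeval nuPoly k)

/-- Evaluation of a polynomial function `P` in the coefficients at a polynomial `g`. -/
noncomputable def evalCoeff {σ : Type} (g : MvPolynomial σ ℂ) (P : MvPolynomial (σ →₀ ℕ) ℂ) : ℂ :=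
  eval (fun d => coeff d g) P

/-- The vanishing ideal of a subset of `ℂ⁵⁶`. -/
noncomputable def vanishingIdealOf (S : Set (Fin 56 → ℂ)) : Ideal (MvPolynomial (Fin 56) ℂ) :=
  ⨅ x ∈ S, RingHom.ker (eval x)

/-- An ideal is a prime ideal of height one: it is prime, admits a prime strictly
below it, and admits no chain of two primes strictly below it. -/
def IsHeightOnePrime {R : Type*} [CommRing R] (I : Ideal R) : Prop :=
  I.IsPrime ∧ (∃ p : Ideal R, p.IsPrime ∧ p < I) ∧
    ∀ p q : Ideal R, p.IsPrime → q.IsPrime → p < q → ¬ q < I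

/-- The space `Q_{f,U}` of quadratic forms vanishing on `U` and apolar to `f`. -/
def QfU (f : MvPolynomial (Fin 6) ℂ) (U : Submodule ℂ (Fin 6 → ℂ)) :
    Set (MvPolynomial (Fin 6) ℂ) :=
  {q | q.IsHomogeneous 2 ∧ (∀ u ∈ U, eval u q = 0) ∧ apolar q f = 0}

/-- The Zariski closure of a subset of `ℂ⁵⁶`. -/
def zcl (S : Set (Fin 56 → ℂ)) : Set (Fin 56 → ℂ) :=
  {x | ∀ P : MvPolynomial (Fin 56) ℂ, (∀ y ∈ S, eval y P = 0) → eval x P = 0}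

/-- The projection of a polynomial onto its squarefree monomials. -/
noncomputable def sqfreeProj (f : MvPolynomial (Fin 6) ℂ) : MvPolynomial (Fin 6) ℂ :=
  ∑ d ∈ f.support.filter (fun d => ∀ i, d i ≤ 1), monomial d (coeff d f)


section Elimination

attribute [local instance] MvPolynomial.gradedAlgebra

/-- A homogeneous polynomial whose coefficients lie in an ideal `I` lies in `I` times the
homogeneous polynomials of its degree. -/
lemma mem_smul_homogeneousSubmodule {σ A : Type*} [CommRing A] {I : Ideal A} {D : ℕ}
    {p : MvPolynomial σ A} (hp : p.IsHomogeneous D) (hI : ∀ m, coeff m p ∈ I) :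
    p ∈ I • homogeneousSubmodule σ A D := by
  rw [p.as_sum]
  refine Submodule.sum_mem _ fun m hm => ?_
  rw [← mul_one (coeff m p), ← smul_eq_mul, ← smul_monomial]
  refine Submodule.smul_mem_smul (hI m) ?_
  exact isHomogeneous_monomial _ (hp.degree_eq_sum_deg_support hm).symm

/-- **Elimination.** If a family of forms over `A` has, after specialization along a surjection
`φ` onto an algebraically closed field, only the trivial common zero, then some `r` with
`φ r = 1` multiplies a power of every variable into the ideal generated by the family. -/
theorem exists_C_mul_X_pow_mem_span {σ J A K : Type*} [Finite σ] [CommRing A] [Field K]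
    [IsAlgClosed K] (φ : A →+* K) (hφ : Function.Surjective φ) (F : J → MvPolynomial σ A)
    (hF : ∀ j, ∃ d, (F j).IsHomogeneous d)
    (h : ∀ v : σ → K, (∀ j, eval v (map φ (F j)) = 0) → v = 0) :
    ∃ r : A, φ r = 1 ∧ ∃ D, ∀ i, C r * X i ^ D ∈ Ideal.span (Set.range F) := by
  set I := Ideal.span (Set.range F)
  set I₀ := I.map (map φ : MvPolynomial σ A →+* MvPolynomial σ K)
  have hom : I.IsHomogeneous (homogeneousSubmodule σ A) := by
    refine Ideal.homogeneous_span _ _ ?_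
    rintro _ ⟨j, rfl⟩
    exact hF j
  have hrad : Ideal.span (Set.range (X : σ → MvPolynomial σ K)) ≤ I₀.radical := by
    rw [← vanishingIdeal_zeroLocus_eq_radical (K := K), Ideal.span_le]
    rintro _ ⟨i, rfl⟩
    rw [SetLike.mem_coe, mem_vanishingIdeal_iff]
    intro v hv
    have : v = 0 := h v fun j => by
      simpa [aeval_eq_eval] using
        hv _ (Ideal.mem_map_of_mem _ (Ideal.subset_span (Set.mem_range_self j)))
    simp [this]
  obtain ⟨D, hD⟩ := Ideal.exists_pow_le_of_le_radical_of_fg hrad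
    (Submodule.fg_span (Set.finite_range _))
  have hmem : ∀ p : MvPolynomial σ K, p.IsHomogeneous D → p ∈ I₀ := by
    intro p hp
    refine hD ((Ideal.mem_span_pow_iff_exists_isHomogeneous _ _).2
      ⟨map C p, hp.map _, ?_⟩)
    rw [eval_map, eval₂_eta]
  set π := (Ideal.Quotient.mkₐ A I).toLinearMap
  obtain ⟨r, hr, hrN⟩ := Submodule.exists_sub_one_mem_and_smul_eq_zero_of_fg_of_le_smul
    (RingHom.ker φ) ((homogeneousSubmodule σ A D).map π)
    ((homogeneousSubmodule_fg σ A D).map π) (by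
      rw [← Submodule.map_smul'']
      rintro _ ⟨p, hp, rfl⟩
      obtain ⟨q, hq, hqp⟩ := (Ideal.mem_map_iff_of_surjective _ (map_surjective φ hφ)).1
        (hmem (map φ p) (IsHomogeneous.map hp φ))
      refine ⟨p - homogeneousComponent D q, mem_smul_homogeneousSubmodule
        (IsHomogeneous.sub hp (homogeneousComponent_isHomogeneous D q)) fun m => ?_, ?_⟩
      · rw [RingHom.mem_ker, coeff_sub, coeff_homogeneousComponent]
        have hc : φ (coeff m q) = φ (coeff m p) := by rw [← coeff_map, hqp, coeff_map]
        split_ifs with hm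
        · rw [map_sub, hc, sub_self]
        · rw [IsHomogeneous.coeff_eq_zero hp hm, sub_zero, map_zero]
      · rw [map_sub, sub_eq_self]
        exact Ideal.Quotient.eq_zero_iff_mem.2 (homogeneousComponent_mem_of_mem hom hq D))
  refine ⟨r, ?_, D, fun i => ?_⟩
  · rwa [RingHom.mem_ker, map_sub, map_one, sub_eq_zero] at hr
  · have := hrN _ ⟨X i ^ D, isHomogeneous_X_pow i D, rfl⟩
    rw [← map_smul] at this
    rw [← smul_eq_C_mul]
    exact Ideal.Quotient.eq_zero_iff_mem.1 this

end Elimination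

section Pairing

variable {n : ℕ}

lemma coeff_pderiv_pow (i : Fin n) (k : ℕ) (e : Fin n →₀ ℕ) (f : MvPolynomial (Fin n) ℂ) :
    coeff e ((((pderiv (R := ℂ) i).toLinearMap :
      Module.End ℂ (MvPolynomial (Fin n) ℂ)) ^ k) f) * ((e i).factorial : ℂ) =
      ((e i + k).factorial : ℂ) * coeff (e + Finsupp.single i k) f := by
  induction k generalizing f with
  | zero => simp [mul_comm]
  | succ k ih =>
    rw [pow_succ, Module.End.mul_apply, ih, Derivation.coeFn_coe, coeff_pderiv, add_assoc,
      ← Finsupp.single_add, ← add_assoc, Nat.factorial_succ]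
    simp only [Finsupp.add_apply, Finsupp.single_eq_same]
    push_cast
    ring

lemma coeff_prod_pderiv_pow (d : Fin n →₀ ℕ) (f : MvPolynomial (Fin n) ℂ) (l : List (Fin n))
    (hl : l.Nodup) (e : Fin n →₀ ℕ) (he : ∀ i ∈ l, e i = 0) :
    coeff e ((l.map fun i => ((pderiv (R := ℂ) i).toLinearMap :
      Module.End ℂ (MvPolynomial (Fin n) ℂ)) ^ d i).prod f) =
      (l.map fun i => ((d i).factorial : ℂ)).prod *
        coeff (e + (l.map fun i => Finsupp.single i (d i)).sum) f := by
  induction l generalizing e with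
  | nil => simp
  | cons i l ih =>
    obtain ⟨hi, hl⟩ := List.nodup_cons.1 hl
    have h0 := coeff_pderiv_pow i (d i) e ((l.map fun i => ((pderiv (R := ℂ) i).toLinearMap :
      Module.End ℂ (MvPolynomial (Fin n) ℂ)) ^ d i).prod f)
    rw [he i List.mem_cons_self, Nat.factorial_zero, Nat.cast_one, mul_one, zero_add,
      ih hl] at h0
    · rw [List.map_cons, List.prod_cons, Module.End.mul_apply, h0, List.map_cons, List.prod_cons,
        List.map_cons, List.sum_cons, add_assoc, mul_assoc]
    · intro j hj
      have hij : i ≠ j := fun h => hi (h ▸ hj)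
      simp [he j (List.mem_cons_of_mem _ hj), Finsupp.single_eq_of_ne hij.symm]

lemma eval_zero_monOp (d : Fin n →₀ ℕ) (f : MvPolynomial (Fin n) ℂ) :
    eval (fun _ => (0 : ℂ)) (monOp d f) = (∏ i, ((d i).factorial : ℂ)) * coeff d f := by
  have h := coeff_prod_pderiv_pow d f (List.finRange n) (List.nodup_finRange n) 0 (by simp)
  have hd : ((List.finRange n).map fun i => Finsupp.single i (d i)).sum = d := by
    rw [← List.ofFn_eq_map, List.sum_ofFn, Finsupp.univ_sum_single]
  rw [← List.ofFn_eq_map, ← List.ofFn_eq_map, List.prod_ofFn, hd, zero_add] at h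
  rw [monOp, ← h]
  exact congrFun (congrArg _ eval_zero) _

lemma pairing_eq_sum (f k : MvPolynomial (Fin n) ℂ) :
    pairing f k = ∑ d ∈ k.support, coeff d k * ((∏ i, ((d i).factorial : ℂ)) * coeff d f) := by
  simp only [pairing, apolar, map_sum, smul_eval, eval_zero_monOp]

lemma pairing_eq_sum_of_subset (f k : MvPolynomial (Fin n) ℂ) {s : Finset (Fin n →₀ ℕ)}
    (hs : k.support ⊆ s) :
    pairing f k = ∑ d ∈ s, coeff d k * ((∏ i, ((d i).factorial : ℂ)) * coeff d f) := by
  rw [pairing_eq_sum]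
  exact Finset.sum_subset hs fun d _ hd => by rw [notMem_support_iff.1 hd, zero_mul]

lemma pairing_monomial (f : MvPolynomial (Fin n) ℂ) (d : Fin n →₀ ℕ) (r : ℂ) :
    pairing f (monomial d r) = r * ((∏ i, ((d i).factorial : ℂ)) * coeff d f) := by
  rw [pairing_eq_sum_of_subset f _ support_monomial_subset, Finset.sum_singleton, coeff_monomial,
    if_pos rfl]

lemma pairing_monomial_X_mul (f : MvPolynomial (Fin n) ℂ) (i : Fin n) (d : Fin n →₀ ℕ) (r : ℂ) :
    pairing f (X i * monomial d r) = pairing (pderiv i f) (monomial d r) := by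
  have hprod : (∏ j, (((d + Finsupp.single i 1 : Fin n →₀ ℕ) j).factorial : ℂ)) =
      (d i + 1) * ∏ j, ((d j).factorial : ℂ) := by
    rw [← Finset.mul_prod_erase _ _ (Finset.mem_univ i),
      ← Finset.mul_prod_erase _ (fun j => ((d j).factorial : ℂ)) (Finset.mem_univ i),
      Finset.prod_congr rfl fun j hj => ?_]
    · simp only [Finsupp.add_apply, Finsupp.single_eq_same, Nat.factorial_succ]
      push_cast
      ring
    · rw [Finsupp.add_apply, Finsupp.single_eq_of_ne (Finset.ne_of_mem_erase hj), add_zero]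
  rw [X, monomial_mul, one_mul, add_comm, pairing_monomial, pairing_monomial, coeff_pderiv, hprod]
  ring

lemma pairing_sum_C_mul {ι : Type*} (s : Finset ι) (a : ι → ℂ) (f : ι → MvPolynomial (Fin n) ℂ)
    (k : MvPolynomial (Fin n) ℂ) :
    pairing (∑ i ∈ s, C (a i) * f i) k = ∑ i ∈ s, a i * pairing (f i) k := by
  simp only [pairing_eq_sum, coeff_sum, coeff_C_mul, Finset.mul_sum]
  rw [Finset.sum_comm]
  exact Finset.sum_congr rfl fun i _ => Finset.sum_congr rfl fun d _ => by ring

lemma pairing_X_mul_X_mul_X (f : MvPolynomial (Fin n) ℂ) (a b c : Fin n) :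
    pairing f (X a * X b * X c) = pairing (pderiv c f) (X a * X b) := by
  have h : (X a * X b : MvPolynomial (Fin n) ℂ) =
      monomial (Finsupp.single a 1 + Finsupp.single b 1) 1 := by
    rw [X, X, monomial_mul, one_mul]
  rw [mul_comm, h, pairing_monomial_X_mul]

lemma pairing_X_mul_X (q : MvPolynomial (Fin n) ℂ) (a b : Fin n) :
    pairing q (X a * X b) = coeff 0 (pderiv b (pderiv a q)) := by
  have hb : (X b : MvPolynomial (Fin n) ℂ) = X b * monomial 0 1 := (mul_one _).symm
  rw [show pairing q (X a * X b) = pairing (pderiv a q) (X b) from pairing_monomial_X_mul q a _ _,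
    hb, pairing_monomial_X_mul, pairing_monomial]
  simp

lemma pairing_quadratic (M : Matrix (Fin n) (Fin n) ℂ) (a b : Fin n) :
    pairing (∑ i, ∑ j, C (M i j) * (X i * X j)) (X a * X b) = M a b + M b a := by
  have key : ∀ i j, coeff 0 (pderiv b (pderiv a (C (M i j) * (X i * X j)))) =
      M i j * ((if i = a then 1 else 0) * (if j = b then 1 else 0)) +
        M i j * ((if i = b then 1 else 0) * (if j = a then 1 else 0)) := by
    intro i j
    simp only [Derivation.leibniz, pderiv_X, Pi.single_apply, map_add, smul_eq_mul,
      coeff_C_mul, coeff_add]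
    split_ifs <;> simp [mul_add]
  simp only [pairing_X_mul_X, map_sum, coeff_sum, key]
  simp [Finset.sum_add_distrib]

end Pairing

/-- The contraction of a trilinear form `L` with the vector `v` in its last argument. -/
def contract {R : Type*} [CommRing R] (L : Fin 6 → Fin 6 → Fin 6 → R) (v : Fin 6 → R) :
    Matrix (Fin 6) (Fin 6) R :=
  Matrix.of fun a b => ∑ c, L a b c * v c

lemma QuadRankLe.det_submatrix_eq_zero {f : MvPolynomial (Fin 6) ℂ} {v : Fin 6 → ℂ} {r : ℕ}
    (h : QuadRankLe (pdir v f) r) (e₁ e₂ : Fin (r + 1) → Fin 6) :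
    ((contract (fun a b c => pairing f (X a * X b * X c)) v).submatrix e₁ e₂).det = 0 := by
  obtain ⟨M, hM, hr, hq⟩ := h
  have hpoly : pdir v f = ∑ i, ∑ j, C (M i j) * (X i * X j) := by
    refine MvPolynomial.funext fun x => ?_
    simp [hq, mul_assoc]
  have hN : contract (fun a b c => pairing f (X a * X b * X c)) v = (2 : ℂ) • M := by
    ext a b
    have := pairing_quadratic M a b
    rw [← hpoly, pdir, pairing_sum_C_mul, hM.apply a b] at this
    simp only [contract, Matrix.of_apply, pairing_X_mul_X_mul_X, Matrix.smul_apply, smul_eq_mul,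
      two_mul, ← this]
    exact Finset.sum_congr rfl fun c _ => mul_comm _ _
  rw [hN, Matrix.submatrix_smul, Pi.smul_apply, Pi.smul_apply, Matrix.det_smul]
  refine mul_eq_zero_of_right _ ?_
  by_contra hdet
  have h1 := Matrix.rank_of_isUnit (M.submatrix e₁ e₂)
    ((Matrix.isUnit_iff_isUnit_det _).2 (isUnit_iff_ne_zero.2 hdet))
  have h2 := M.rank_submatrix_le e₁ e₂
  rw [Fintype.card_fin] at h1
  omega

/-- The polynomial in the coefficients of `g` whose value is `⟨g, k⟩`. -/
noncomputable def pairingPoly {n : ℕ} (k : MvPolynomial (Fin n) ℂ) :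
    MvPolynomial (Fin n →₀ ℕ) ℂ :=
  ∑ d ∈ k.support, C (coeff d k * ∏ i, ((d i).factorial : ℂ)) * X d

lemma eval_pairingPoly {n : ℕ} (g k : MvPolynomial (Fin n) ℂ) :
    eval (fun d => coeff d g) (pairingPoly k) = pairing g k := by
  simp [pairingPoly, pairing_eq_sum, mul_assoc]

/-- The matrix of `∂_v s(g)` with generic `g` and `v`. -/
noncomputable def genericMatrix :
    Matrix (Fin 6) (Fin 6) (MvPolynomial (Fin 6) (MvPolynomial (Fin 3 →₀ ℕ) ℂ)) :=
  contract (fun a b c => C (pairingPoly (nuPoly a * nuPoly b * nuPoly c))) X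

lemma genericMatrix_minor_isHomogeneous (e₁ e₂ : Fin 4 → Fin 6) :
    (genericMatrix.submatrix e₁ e₂).det.IsHomogeneous 4 := by
  rw [Matrix.det_apply']
  refine IsHomogeneous.sum _ _ _ fun σ _ => ?_
  have hprod : (∏ i, genericMatrix.submatrix e₁ e₂ (σ i) i).IsHomogeneous (∑ _i : Fin 4, 1) :=
    IsHomogeneous.prod _ _ _ fun i _ => by
      simp only [genericMatrix, contract, Matrix.submatrix_apply, Matrix.of_apply]
      exact IsHomogeneous.sum _ _ _ fun c _ => isHomogeneous_C_mul_X _ _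
  have hsign := (isHomogeneous_C (Fin 6)
    ((Equiv.Perm.sign σ : ℤ) : MvPolynomial (Fin 3 →₀ ℕ) ℂ)).mul hprod
  simpa using hsign

lemma eval_genericMatrix_minor (g : MvPolynomial (Fin 3) ℂ) (v : Fin 6 → ℂ)
    (e₁ e₂ : Fin 4 → Fin 6) :
    eval v (map (eval fun d => coeff d g) (genericMatrix.submatrix e₁ e₂).det) =
      ((contract (fun a b c => pairing g (nuPoly a * nuPoly b * nuPoly c)) v).submatrix
        e₁ e₂).det := by
  rw [RingHom.map_det, RingHom.map_det]
  congr 1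
  ext i j
  simp [genericMatrix, contract, eval_pairingPoly]

section Witness

/-- The exponents of the components of the Veronese map. -/
noncomputable def nuExp : Fin 6 → Fin 3 →₀ ℕ :=
  ![Finsupp.single 0 2, Finsupp.single 0 1 + Finsupp.single 1 1,
    Finsupp.single 0 1 + Finsupp.single 2 1, Finsupp.single 1 2,
    Finsupp.single 1 1 + Finsupp.single 2 1, Finsupp.single 2 2]

/-- The coefficients of the components of the Veronese map. -/
noncomputable def nuCoeff : Fin 6 → ℂ := ![1, 2, 2, 1, 2, 1]

lemma nuPoly_eq_monomial (a : Fin 6) : nuPoly a = monomial (nuExp a) (nuCoeff a) := by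
  have two : (2 : MvPolynomial (Fin 3) ℂ) = C 2 := (map_ofNat C 2).symm
  fin_cases a <;>
    simp [nuPoly, nuExp, nuCoeff, X, two, monomial_pow, C_mul_monomial, monomial_mul]

/-- The exponent `(p, q, r)` of a ternary monomial. -/
noncomputable def ternaryExp (p q r : ℕ) : Fin 3 →₀ ℕ :=
  Finsupp.single 0 p + Finsupp.single 1 q + Finsupp.single 2 r

lemma eq_ternaryExp_iff (d : Fin 3 →₀ ℕ) (p q r : ℕ) :
    ternaryExp p q r = d ↔ d 0 = p ∧ d 1 = q ∧ d 2 = r := by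
  simp [Finsupp.ext_iff, Fin.forall_fin_succ, ternaryExp, eq_comm]

/-- A sextic `g` none of whose contractions with a nonzero quadric has a middle catalecticant
of rank at most three. -/
noncomputable def witness : MvPolynomial (Fin 3) ℂ :=
  monomial (ternaryExp 4 2 0) (1 / 48) + monomial (ternaryExp 1 3 2) (1 / 12) +
    monomial (ternaryExp 3 0 3) (1 / 36) + monomial (ternaryExp 0 1 5) (1 / 60)

lemma witness_isHomogeneous : witness.IsHomogeneous 6 := by
  have h : ∀ p q r : ℕ, (ternaryExp p q r).degree = p + q + r := by
    simp [ternaryExp]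
  refine (((isHomogeneous_monomial _ ?_).add (isHomogeneous_monomial _ ?_)).add
    (isHomogeneous_monomial _ ?_)).add (isHomogeneous_monomial _ ?_) <;> rw [h]

lemma factorial_mul_coeff_witness (d : Fin 3 →₀ ℕ) :
    (∏ i, ((d i).factorial : ℂ)) * coeff d witness =
      if d 0 = 4 ∧ d 1 = 2 ∧ d 2 = 0 then 1 else
      if d 0 = 1 ∧ d 1 = 3 ∧ d 2 = 2 then 1 else
      if d 0 = 3 ∧ d 1 = 0 ∧ d 2 = 3 then 1 else
      if d 0 = 0 ∧ d 1 = 1 ∧ d 2 = 5 then 2 else 0 := by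
  simp only [witness, coeff_add, coeff_monomial, eq_ternaryExp_iff, Fin.prod_univ_three]
  split_ifs <;> simp_all [Nat.factorial] <;> norm_num

lemma contract_witness (v : Fin 6 → ℂ) :
    contract (fun a b c => pairing witness (nuPoly a * nuPoly b * nuPoly c)) v =
      !![v 3, 4 * v 1, 2 * v 5, v 0, 0, 2 * v 2;
         4 * v 1, 4 * v 0, 0, 2 * v 5, 8 * v 4, 2 * v 3;
         2 * v 5, 0, 8 * v 2, 4 * v 4, 4 * v 3, 2 * v 0;
         v 0, 2 * v 5, 4 * v 4, 0, 4 * v 2, 2 * v 1;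
         0, 8 * v 4, 4 * v 3, 4 * v 2, 8 * v 1, 4 * v 5;
         2 * v 2, 2 * v 3, 2 * v 0, 2 * v 1, 4 * v 5, 4 * v 4] := by
  ext a b
  simp only [contract, Matrix.of_apply, nuPoly_eq_monomial, monomial_mul, pairing_monomial,
    factorial_mul_coeff_witness]
  fin_cases a <;> fin_cases b <;>
    simp [Fin.sum_univ_six, nuExp, nuCoeff] <;> norm_num

lemma det_fin_four {R : Type*} [CommRing R] (A : Matrix (Fin 4) (Fin 4) R) :
    A.det =
      A 0 0 * (A 1 1 * (A 2 2 * A 3 3 - A 2 3 * A 3 2) - A 1 2 * (A 2 1 * A 3 3 - A 2 3 * A 3 1) +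
        A 1 3 * (A 2 1 * A 3 2 - A 2 2 * A 3 1)) -
      A 0 1 * (A 1 0 * (A 2 2 * A 3 3 - A 2 3 * A 3 2) - A 1 2 * (A 2 0 * A 3 3 - A 2 3 * A 3 0) +
        A 1 3 * (A 2 0 * A 3 2 - A 2 2 * A 3 0)) +
      A 0 2 * (A 1 0 * (A 2 1 * A 3 3 - A 2 3 * A 3 1) - A 1 1 * (A 2 0 * A 3 3 - A 2 3 * A 3 0) +
        A 1 3 * (A 2 0 * A 3 1 - A 2 1 * A 3 0)) -
      A 0 3 * (A 1 0 * (A 2 1 * A 3 2 - A 2 2 * A 3 1) - A 1 1 * (A 2 0 * A 3 2 - A 2 2 * A 3 0) +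
        A 1 2 * (A 2 0 * A 3 1 - A 2 1 * A 3 0)) := by
  simp [Matrix.det_succ_row_zero, Fin.sum_univ_succ, Fin.succAbove]
  ring

lemma eq_zero_of_witness_minors_eq_zero (v : Fin 6 → ℂ)
    (h : ∀ e₁ e₂ : Fin 4 → Fin 6,
      ((contract (fun a b c => pairing witness (nuPoly a * nuPoly b * nuPoly c)) v).submatrix
        e₁ e₂).det = 0) : v = 0 := by
  simp only [contract_witness, det_fin_four, Matrix.submatrix_apply] at h
  have h5 : v 5 = 0 := by
    have m₁ := h ![0, 2, 3, 5] ![2, 3, 4, 5]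
    have m₂ := h ![0, 1, 2, 3] ![0, 1, 2, 3]
    have m₃ := h ![0, 1, 3, 4] ![0, 3, 4, 5]
    have m₄ := h ![0, 1, 3, 5] ![1, 2, 3, 4]
    have m₅ := h ![0, 1, 2, 3] ![0, 2, 3, 4]
    have m₆ := h ![1, 2, 3, 4] ![1, 2, 3, 5]
    have m₇ := h ![1, 3, 4, 5] ![1, 3, 4, 5]
    simp at m₁ m₂ m₃ m₄ m₅ m₆ m₇
    refine pow_eq_zero_iff (n := 5) (by norm_num) |>.1 ?_
    linear_combination -v 5 / 8 * m₁ + v 5 / 16 * m₂ + v 5 / 8 * m₃ - v 5 / 8 * m₄ -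
      v 3 / 16 * m₅ - v 3 / 32 * m₆ + v 5 / 16 * m₇
  have h0 : v 0 = 0 := by
    have m₁ := h ![0, 1, 3, 5] ![1, 3, 4, 5]
    have m₂ := h ![0, 1, 4, 5] ![0, 2, 3, 5]
    have m₃ := h ![0, 1, 4, 5] ![0, 1, 4, 5]
    have m₄ := h ![0, 2, 3, 5] ![0, 2, 3, 5]
    simp [h5] at m₁ m₂ m₃ m₄
    refine pow_eq_zero_iff (n := 4) (by norm_num) |>.1 ?_
    linear_combination -m₁ / 4 - m₂ / 8 - m₃ / 16 + m₄ / 4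
  have h1 : v 1 = 0 := by
    simpa [h5, h0] using h ![0, 1, 3, 5] ![0, 1, 3, 5]
  have h3 : v 3 = 0 := by
    simpa [h5, h0, h1] using h ![0, 1, 2, 5] ![0, 1, 4, 5]
  have h2 : v 2 = 0 := by
    simpa [h5, h0, h1, h3] using h ![0, 3, 4, 5] ![0, 3, 4, 5]
  have h4 : v 4 = 0 := by
    simpa [h5, h0, h1, h3, h2] using h ![1, 2, 3, 4] ![1, 2, 3, 4]
  ext i
  fin_cases i <;> assumption

end Witness

lemma quadRankLe_zero (r : ℕ) : QuadRankLe 0 r :=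
  ⟨0, Matrix.isSymm_zero, by simp, by simp⟩

lemma IsSMap.pairing_X {s : MvPolynomial (Fin 3) ℂ →ₗ[ℂ] MvPolynomial (Fin 6) ℂ} (hs : IsSMap s)
    {g : MvPolynomial (Fin 3) ℂ} (hg : g.IsHomogeneous 6) (a b c : Fin 6) :
    pairing (s g) (X a * X b * X c) = pairing g (nuPoly a * nuPoly b * nuPoly c) := by
  have h := hs.2 g (X a * X b * X c) hg
    (((isHomogeneous_X ℂ a).mul (isHomogeneous_X ℂ b)).mul (isHomogeneous_X ℂ c))
  rwa [map_mul, map_mul, aeval_X, aeval_X, aeval_X] at h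

/-- **Lemma 2.4.** A general cubic fourfold apolar to a Veronese surface has no nonzero
partial derivative of rank `≤ 3`. -/
theorem statement7 :
    ∃ P : MvPolynomial ((Fin 3) →₀ ℕ) ℂ,
      (∃ g₀ : MvPolynomial (Fin 3) ℂ, g₀.IsHomogeneous 6 ∧ evalCoeff g₀ P ≠ 0) ∧
      ∀ g : MvPolynomial (Fin 3) ℂ, g.IsHomogeneous 6 → evalCoeff g P ≠ 0 →
        ∀ s : MvPolynomial (Fin 3) ℂ →ₗ[ℂ] MvPolynomial (Fin 6) ℂ, IsSMap s →
          ∀ v : Fin 6 → ℂ, v ≠ 0 →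
            pdir v (s g) ≠ 0 ∧ ¬ QuadRankLe (pdir v (s g)) 3 := by
  obtain ⟨P, hP, D, hD⟩ := exists_C_mul_X_pow_mem_span (eval fun d => coeff d witness)
    (fun z => ⟨C z, eval_C z⟩)
    (fun e : (Fin 4 → Fin 6) × (Fin 4 → Fin 6) => (genericMatrix.submatrix e.1 e.2).det)
    (fun e => ⟨4, genericMatrix_minor_isHomogeneous e.1 e.2⟩)
    (fun v hv => eq_zero_of_witness_minors_eq_zero v fun e₁ e₂ => by
      rw [← eval_genericMatrix_minor]
      exact hv (e₁, e₂))
  refine ⟨P, ⟨witness, witness_isHomogeneous, by simp [evalCoeff, hP]⟩, ?_⟩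
  intro g hg hPg s hs v hv
  have key : ¬ QuadRankLe (pdir v (s g)) 3 := by
    intro hq
    refine hv (funext fun i => ?_)
    have hle : Ideal.span (Set.range fun e : (Fin 4 → Fin 6) × (Fin 4 → Fin 6) =>
        (genericMatrix.submatrix e.1 e.2).det) ≤
        RingHom.ker ((eval v).comp (map (eval fun d => coeff d g))) := by
      rw [Ideal.span_le]
      rintro _ ⟨e, rfl⟩
      rw [SetLike.mem_coe, RingHom.mem_ker, RingHom.comp_apply, eval_genericMatrix_minor]
      simpa only [hs.pairing_X hg] using hq.det_submatrix_eq_zero e.1 e.2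
    have hi := hle (hD i)
    rw [RingHom.mem_ker, RingHom.comp_apply, map_mul, map_mul, map_C, eval_C, map_pow, map_pow,
      map_X, eval_X] at hi
    exact eq_zero_of_pow_eq_zero ((mul_eq_zero.1 hi).resolve_left hPg)
  exact ⟨fun h => key (h ▸ quadRankLe_zero 3), key⟩
end

section
/- Let f ∈ ℂ[x₀,…,x₅] be a cubic form whose six partial derivatives ∂f/∂x₀, …, ∂f/∂x₅ are linearly independent and which has no nonzero directional partial derivative of rank ≤ 3 (i.e., for all v ∈ ℂ⁶ ∖ {0}, rank(∂_v f) ≥ 4). Then for every 2-dimensional linear subspace U ⊆ ℂ⁶, the space {q a quadratic form in x₀,…,x₅ : q vanishes identically on U and q∘f = 0} has dimension exactly 12. (Transversality claim for I_Δ(2) ∩ Q_f in the proof of Proposition 3.1 of the paper.) -/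
open MvPolynomial

namespace MvPolynomial

/-- Partial derivatives commute. -/
theorem commute_pderiv {n : ℕ} (i j : Fin n) :
    Commute ((pderiv (R := ℂ) i).toLinearMap : Module.End ℂ (MvPolynomial (Fin n) ℂ))
      (pderiv (R := ℂ) j).toLinearMap := by
  have h : ⁅pderiv (R := ℂ) i, pderiv (R := ℂ) j⁆ = 0 := by
    refine derivation_ext fun k => ?_
    simp [Derivation.commutator_apply, pderiv_X, Pi.single_apply, apply_ite]
  refine LinearMap.ext fun p => ?_
  have := congrArg (fun D => D p) h
  simpa [Derivation.commutator_apply, sub_eq_zero] using this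

theorem pderiv_comm {n : ℕ} (i j : Fin n) (p : MvPolynomial (Fin n) ℂ) :
    pderiv i (pderiv j p) = pderiv j (pderiv i p) :=
  LinearMap.congr_fun (commute_pderiv i j) p

theorem IsHomogeneous.eq_C_eval_zero {σ R : Type*} [CommSemiring R] {p : MvPolynomial σ R}
    (hp : p.IsHomogeneous 0) : p = C (eval (fun _ => (0 : R)) p) := by
  rw [← totalDegree_zero_iff_isHomogeneous, totalDegree_eq_zero_iff_eq_C] at hp
  rw [hp]
  simp

/-- A linear form is determined by its (constant) partial derivatives. -/
theorem IsHomogeneous.eval_eq_sum_pderiv {σ R : Type*} [Fintype σ] [CommSemiring R]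
    {p : MvPolynomial σ R} (hp : p.IsHomogeneous 1) (x : σ → R) :
    eval x p = ∑ i, x i * eval (fun _ => (0 : R)) (pderiv i p) := by
  have h := congrArg (eval x) hp.sum_X_mul_pderiv
  rw [one_smul, map_sum] at h
  rw [← h]
  refine Finset.sum_congr rfl fun i _ => ?_
  have h0 : (pderiv i p).IsHomogeneous 0 := hp.pderiv
  rw [map_mul, eval_X]
  conv_lhs => rw [h0.eq_C_eval_zero, eval_C]

/-- A quadratic form is given by half its Hessian matrix. -/
theorem IsHomogeneous.eval_eq_sum_hessian {σ R : Type*} [Fintype σ] [Field R] [CharZero R]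
    {p : MvPolynomial σ R} (hp : p.IsHomogeneous 2) (x : σ → R) :
    eval x p =
      ∑ i, ∑ j, 2⁻¹ * eval (fun _ => (0 : R)) (pderiv j (pderiv i p)) * x i * x j := by
  have h := congrArg (eval x) hp.sum_X_mul_pderiv
  rw [map_sum, map_nsmul, nsmul_eq_mul] at h
  have h' : eval x p = 2⁻¹ * ∑ i, eval x (X i * pderiv i p) := by
    rw [h]; push_cast; field_simp
  rw [h', Finset.mul_sum]
  refine Finset.sum_congr rfl fun i _ => ?_
  have h1 : (pderiv i p).IsHomogeneous 1 := hp.pderiv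
  rw [map_mul, eval_X, h1.eval_eq_sum_pderiv, Finset.mul_sum, Finset.mul_sum]
  exact Finset.sum_congr rfl fun j _ => by ring

/-- The restriction of a quadratic form to a plane is determined by three values. -/
theorem IsHomogeneous.eval_smul_add_smul {σ R : Type*} [Fintype σ] [Field R] [CharZero R]
    {p : MvPolynomial σ R} (hp : p.IsHomogeneous 2) (a b : R) (x y : σ → R) :
    eval (a • x + b • y) p = a ^ 2 * eval x p + b ^ 2 * eval y p +
      a * b * (eval (x + y) p - eval x p - eval y p) := by
  simp only [hp.eval_eq_sum_hessian, Finset.mul_sum, ← Finset.sum_add_distrib,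
    ← Finset.sum_sub_distrib, Pi.add_apply, Pi.smul_apply, smul_eq_mul]
  exact Finset.sum_congr rfl fun i _ => Finset.sum_congr rfl fun j _ => by ring

theorem finrank_homogeneousSubmodule {σ R : Type*} [Fintype σ] [DecidableEq σ] [CommRing R]
    [Nontrivial R] (n : ℕ) : Module.finrank R (homogeneousSubmodule σ R n) =
      (Fintype.card σ + n - 1).choose n := by
  rw [homogeneousSubmodule_eq_finsupp_supported]
  let e : {d : σ →₀ ℕ | d.degree = n} ≃ Sym σ n :=
    (Equiv.subtypeEquivRight fun d => by
      simp [Finsupp.degree_eq_sum, Finsupp.sum_fintype]).trans (Sym.equivNatSum σ n).symm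
  let _ : Fintype {d : σ →₀ ℕ | d.degree = n} := Fintype.ofEquiv _ e.symm
  rw [(AddMonoidAlgebra.supportedEquivFinsupp {d : σ →₀ ℕ | d.degree = n}).finrank_eq,
    Module.finrank_finsupp_self, Fintype.card_congr e, Sym.card_sym_eq_choose]

end MvPolynomial

theorem monOp_add {n : ℕ} (d e : Fin n →₀ ℕ) : monOp (d + e) = monOp d * monOp e := by
  suffices h : ∀ l : List (Fin n),
      (l.map fun i => ((pderiv (R := ℂ) i).toLinearMap :
        Module.End ℂ (MvPolynomial (Fin n) ℂ)) ^ ((d + e) i)).prod =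
      (l.map fun i => ((pderiv (R := ℂ) i).toLinearMap :
        Module.End ℂ (MvPolynomial (Fin n) ℂ)) ^ (d i)).prod *
      (l.map fun i => ((pderiv (R := ℂ) i).toLinearMap :
        Module.End ℂ (MvPolynomial (Fin n) ℂ)) ^ (e i)).prod by
    simpa only [monOp, List.ofFn_eq_map] using h (List.finRange n)
  intro l
  induction l with
  | nil => simp
  | cons i l ih =>
    have hc : Commute (((pderiv (R := ℂ) i).toLinearMap :
        Module.End ℂ (MvPolynomial (Fin n) ℂ)) ^ (e i))
        (l.map fun i => ((pderiv (R := ℂ) i).toLinearMap :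
          Module.End ℂ (MvPolynomial (Fin n) ℂ)) ^ (d i)).prod := by
      refine Commute.list_prod_right _ _ fun x hx => ?_
      obtain ⟨j, -, rfl⟩ := List.mem_map.mp hx
      exact (commute_pderiv i j).pow_pow _ _
    rw [List.map_cons, List.map_cons, List.map_cons, List.prod_cons, List.prod_cons,
      List.prod_cons, ih, Finsupp.add_apply, pow_add, hc.mul_mul_mul_comm]

theorem monOp_single {n : ℕ} (i : Fin n) :
    monOp (Finsupp.single i 1) = (pderiv (R := ℂ) i).toLinearMap := by
  suffices h : ∀ l : List (Fin n), l.Nodup →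
      (l.map fun j => ((pderiv (R := ℂ) j).toLinearMap :
        Module.End ℂ (MvPolynomial (Fin n) ℂ)) ^ (Finsupp.single i 1 j)).prod =
      if i ∈ l then (pderiv (R := ℂ) i).toLinearMap else 1 by
    simpa [monOp, List.ofFn_eq_map] using h (List.finRange n) (List.nodup_finRange n)
  intro l hl
  induction l with
  | nil => simp
  | cons j l ih =>
    obtain ⟨hj, hl⟩ := List.nodup_cons.mp hl
    rw [List.map_cons, List.prod_cons, ih hl]
    by_cases hij : i = j
    · subst hij
      simp [hj]
    · simp [hij]

theorem monOp_isHomogeneous {n m : ℕ} (d : Fin n →₀ ℕ) {f : MvPolynomial (Fin n) ℂ}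
    (hf : f.IsHomogeneous m) : (monOp d f).IsHomogeneous (m - d.degree) := by
  induction d using Finsupp.induction_linear generalizing m f with
  | zero => simpa [monOp] using hf
  | add d e hd he =>
    rw [monOp_add, Module.End.mul_apply, map_add, add_comm, ← Nat.sub_sub]
    exact hd (he hf)
  | single i k =>
    induction k generalizing m f with
    | zero => simpa [monOp] using hf
    | succ k ih =>
      rw [Finsupp.single_add, monOp_add, Module.End.mul_apply, monOp_single, map_add, add_comm,
        ← Nat.sub_sub, Finsupp.degree_single i 1]
      exact ih hf.pderiv

/-- The apolarity action on a fixed `f`, as a linear map in the operator. -/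
noncomputable def apolarHom {n : ℕ} (f : MvPolynomial (Fin n) ℂ) :
    MvPolynomial (Fin n) ℂ →ₗ[ℂ] MvPolynomial (Fin n) ℂ :=
  (basisMonomials (Fin n) ℂ).constr ℂ fun d => monOp d f

theorem apolarHom_apply {n : ℕ} (g f : MvPolynomial (Fin n) ℂ) :
    apolarHom f g = apolar g f := by
  rw [apolarHom, Module.Basis.constr_apply]
  rfl

theorem apolar_X_mul_X {n : ℕ} (i j : Fin n) (f : MvPolynomial (Fin n) ℂ) :
    apolar (X i * X j) f = pderiv i (pderiv j f) := by
  have h : (X i * X j : MvPolynomial (Fin n) ℂ) =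
      basisMonomials (Fin n) ℂ (Finsupp.single i 1 + Finsupp.single j 1) := by
    simp [X, monomial_mul]
  rw [← apolarHom_apply, h, apolarHom, Module.Basis.constr_basis, monOp_add, monOp_single,
    monOp_single]
  rfl

theorem apolar_isHomogeneous {n a b : ℕ} {g f : MvPolynomial (Fin n) ℂ}
    (hg : g.IsHomogeneous a) (hf : f.IsHomogeneous b) :
    (apolar g f).IsHomogeneous (b - a) := by
  refine IsHomogeneous.sum _ _ _ fun d hd => ?_
  have hd' : d.degree = a := by
    rw [Finsupp.degree_eq_weight_one]
    exact hg (mem_support_iff.mp hd)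
  rw [smul_eq_C_mul, ← hd']
  exact (monOp_isHomogeneous d hf).C_mul _

/-- The nine linear conditions on a polynomial `q` expressing that it vanishes on the plane
spanned by `x` and `y` and is apolar to the cubic `f`. -/
noncomputable def transversalityMap (f : MvPolynomial (Fin 6) ℂ) (x y : Fin 6 → ℂ) :
    MvPolynomial (Fin 6) ℂ →ₗ[ℂ] (Fin 3 → ℂ) × (Fin 6 → ℂ) :=
  LinearMap.prod
    (LinearMap.pi ![(aeval x).toLinearMap, (aeval y).toLinearMap,
      (aeval (x + y)).toLinearMap - (aeval x).toLinearMap - (aeval y).toLinearMap])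
    (LinearMap.pi fun k =>
      (aeval fun _ => (0 : ℂ)).toLinearMap ∘ₗ (pderiv k).toLinearMap ∘ₗ apolarHom f)

theorem transversalityMap_apply (f : MvPolynomial (Fin 6) ℂ) (x y : Fin 6 → ℂ)
    (q : MvPolynomial (Fin 6) ℂ) :
    transversalityMap f x y q =
      (![eval x q, eval y q, eval (x + y) q - eval x q - eval y q],
        fun k => eval (fun _ => (0 : ℂ)) (pderiv k (apolar q f))) := by
  refine Prod.ext (funext fun i => ?_) (funext fun k => ?_)
  · fin_cases i <;> simp [transversalityMap]
  · simp [transversalityMap, apolarHom_apply]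

theorem pdir_isHomogeneous {n m : ℕ} {f : MvPolynomial (Fin n) ℂ} (hf : f.IsHomogeneous m)
    (v : Fin n → ℂ) : (pdir v f).IsHomogeneous (m - 1) :=
  IsHomogeneous.sum _ _ _ fun _ _ => hf.pderiv.C_mul _

theorem eval_pderiv_pderiv_pdir {n : ℕ} (f : MvPolynomial (Fin n) ℂ) (v z : Fin n → ℂ)
    (i j : Fin n) : eval z (pderiv i (pderiv j (pdir v f))) =
      ∑ k, v k * eval z (pderiv k (pderiv i (pderiv j f))) := by
  simp only [pdir, map_sum, pderiv_C_mul, map_mul, eval_C]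
  refine Finset.sum_congr rfl fun k _ => ?_
  rw [pderiv_comm k i, pderiv_comm k j]

theorem quadRankLe_of_hessian {q : MvPolynomial (Fin 6) ℂ} (hq : q.IsHomogeneous 2)
    {x y s t : Fin 6 → ℂ}
    (h : ∀ i j, eval (fun _ => (0 : ℂ)) (pderiv i (pderiv j q)) = x i * s j + y i * t j) :
    QuadRankLe q 2 := by
  refine ⟨(Matrix.of ![x, y]).transpose * Matrix.of ![(2⁻¹ : ℂ) • s, (2⁻¹ : ℂ) • t], ?_, ?_, ?_⟩
  · ext i j
    have := h i j
    rw [pderiv_comm, h j i] at this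
    simp only [Matrix.transpose_apply, Matrix.mul_apply, Fin.sum_univ_two, Matrix.of_apply,
      Matrix.cons_val, Pi.smul_apply, smul_eq_mul]
    linear_combination 2⁻¹ * this
  · exact (Matrix.rank_mul_le_left _ _).trans (Matrix.rank_le_width _)
  · intro z
    rw [hq.eval_eq_sum_hessian]
    refine Finset.sum_congr rfl fun i _ => Finset.sum_congr rfl fun j _ => ?_
    rw [pderiv_comm, h i j]
    simp only [Matrix.transpose_apply, Matrix.mul_apply, Fin.sum_univ_two, Matrix.of_apply,
      Matrix.cons_val, Pi.smul_apply, smul_eq_mul]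
    ring

/-- If no partial derivative of the cubic `f` has rank at most `2`, the nine conditions are
independent on quadratic forms. -/
theorem range_transversalityMap_eq_top {f : MvPolynomial (Fin 6) ℂ} (hf : f.IsHomogeneous 3)
    (hrk : ∀ v : Fin 6 → ℂ, v ≠ 0 → ¬ QuadRankLe (pdir v f) 2) {x y : Fin 6 → ℂ}
    (hxy : LinearIndependent ℂ ![x, y]) :
    LinearMap.range ((transversalityMap f x y).domRestrict (homogeneousSubmodule (Fin 6) ℂ 2))
      = ⊤ := by
  by_contra hne
  obtain ⟨φ, hφ, hle⟩ := Submodule.exists_le_ker_of_lt_top _ (lt_top_iff_ne_top.mpr hne)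
  let α : Fin 3 → ℂ := fun k => φ (LinearMap.inl ℂ _ _ fun j => if k = j then 1 else 0)
  let w : Fin 6 → ℂ := fun k => φ (LinearMap.inr ℂ _ _ fun j => if k = j then 1 else 0)
  have hφ_apply : ∀ p, φ p = ∑ k, α k * p.1 k + ∑ k, w k * p.2 k := by
    intro p
    have h1 := LinearMap.pi_apply_eq_sum_univ (φ ∘ₗ LinearMap.inl ℂ _ _) p.1
    have h2 := LinearMap.pi_apply_eq_sum_univ (φ ∘ₗ LinearMap.inr ℂ _ _) p.2
    have hp : p = LinearMap.inl ℂ _ _ p.1 + LinearMap.inr ℂ _ _ p.2 := by simp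
    conv_lhs => rw [hp, map_add]
    rw [LinearMap.comp_apply] at h1 h2
    rw [h1, h2]
    simp only [α, w, LinearMap.comp_apply, smul_eq_mul, mul_comm]
  let s : Fin 6 → ℂ := (-α 0) • x + (-α 2) • y
  let t : Fin 6 → ℂ := (-α 2) • x + (-α 1) • y
  have hhess : ∀ i j, eval (fun _ => (0 : ℂ)) (pderiv i (pderiv j (pdir w f))) =
      x i * s j + y i * t j := by
    intro i j
    have hq : (X i * X j : MvPolynomial (Fin 6) ℂ) ∈ homogeneousSubmodule (Fin 6) ℂ 2 :=
      (isHomogeneous_X ℂ i).mul (isHomogeneous_X ℂ j)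
    have h0 : φ (transversalityMap f x y (X i * X j)) = 0 :=
      hle ⟨⟨X i * X j, hq⟩, rfl⟩
    rw [hφ_apply, transversalityMap_apply, apolar_X_mul_X] at h0
    simp only [← eval_pderiv_pderiv_pdir, Fin.sum_univ_three, map_mul, eval_X, Pi.add_apply,
      Matrix.cons_val] at h0
    simp only [s, t, Pi.add_apply, Pi.smul_apply, smul_eq_mul]
    linear_combination h0
  have hw : w = 0 := by
    by_contra hw
    exact hrk w hw (quadRankLe_of_hessian (pdir_isHomogeneous hf w) hhess)
  have hst : s = 0 ∧ t = 0 := by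
    rw [LinearIndependent.pair_iff] at hxy
    have h : ∀ j, s j = 0 ∧ t j = 0 := fun j => hxy _ _ <| funext fun i => by
      have := hhess i j
      simp only [hw, pdir, Pi.zero_apply, map_zero, zero_mul, Finset.sum_const_zero] at this
      simp only [Pi.add_apply, Pi.smul_apply, smul_eq_mul, Pi.zero_apply]
      linear_combination -this
    exact ⟨funext fun j => (h j).1, funext fun j => (h j).2⟩
  rw [LinearIndependent.pair_iff] at hxy
  obtain ⟨h0, h2⟩ := hxy _ _ hst.1
  obtain ⟨-, h1⟩ := hxy _ _ hst.2
  refine hφ (LinearMap.ext fun p => ?_)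
  rw [hφ_apply, Fin.sum_univ_three, neg_eq_zero.mp h0, neg_eq_zero.mp h1, neg_eq_zero.mp h2, hw]
  simp

/-- For `U` spanned by `x` and `y`, `Q_{f,U}` is cut out by the nine conditions. -/
theorem mem_QfU_iff {f : MvPolynomial (Fin 6) ℂ} (hf : f.IsHomogeneous 3) (x y : Fin 6 → ℂ)
    (q : MvPolynomial (Fin 6) ℂ) : q ∈ QfU f (Submodule.span ℂ {x, y}) ↔
      q.IsHomogeneous 2 ∧ transversalityMap f x y q = 0 := by
  refine and_congr_right fun hq => ?_
  rw [transversalityMap_apply, Prod.mk_eq_zero]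
  refine and_congr ⟨fun h => ?_, fun h => ?_⟩ ⟨fun h => ?_, fun h => ?_⟩
  · have hx : x ∈ Submodule.span ℂ {x, y} := Submodule.subset_span (by simp)
    have hy : y ∈ Submodule.span ℂ {x, y} := Submodule.subset_span (by simp)
    simp [h x hx, h y hy, h _ (add_mem hx hy)]
  · intro u hu
    obtain ⟨a, b, rfl⟩ := Submodule.mem_span_pair.mp hu
    have h0 := congrFun h 0
    have h1 := congrFun h 1
    have h2 := congrFun h 2
    simp only [Matrix.cons_val, Pi.zero_apply] at h0 h1 h2
    rw [hq.eval_smul_add_smul, h2, h0, h1]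
    simp
  · simp [h, funext_iff]
  · refine funext fun z => ?_
    rw [(show (apolar q f).IsHomogeneous 1 from apolar_isHomogeneous hq hf).eval_eq_sum_pderiv]
    exact Finset.sum_eq_zero fun k _ => by rw [congrFun h k, Pi.zero_apply, mul_zero]

theorem finrank_span_QfU {f : MvPolynomial (Fin 6) ℂ} (hf : f.IsHomogeneous 3)
    (hrk : ∀ v : Fin 6 → ℂ, v ≠ 0 → ¬ QuadRankLe (pdir v f) 2) {x y : Fin 6 → ℂ}
    (hxy : LinearIndependent ℂ ![x, y]) :
    Module.finrank ℂ (Submodule.span ℂ (QfU f (Submodule.span ℂ {x, y}))) = 12 := by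
  let T := (transversalityMap f x y).domRestrict (homogeneousSubmodule (Fin 6) ℂ 2)
  have hQ : QfU f (Submodule.span ℂ {x, y}) =
      ((LinearMap.ker T).map (homogeneousSubmodule (Fin 6) ℂ 2).subtype :
        Set (MvPolynomial (Fin 6) ℂ)) := by
    ext q
    rw [mem_QfU_iff hf]
    simp [T, and_comm]
  have h21 : Module.finrank ℂ (homogeneousSubmodule (Fin 6) ℂ 2) = 21 := by
    rw [finrank_homogeneousSubmodule]
    rfl
  have : FiniteDimensional ℂ (homogeneousSubmodule (Fin 6) ℂ 2) :=
    Module.finite_of_finrank_pos (by rw [h21]; norm_num)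
  have hrank := LinearMap.finrank_range_add_finrank_ker T
  rw [range_transversalityMap_eq_top hf hrk hxy, finrank_top, h21] at hrank
  simp only [Module.finrank_prod, Module.finrank_fin_fun] at hrank
  rw [hQ, Submodule.span_eq, Submodule.finrank_map_subtype_eq]
  lia

/-- **Transversality claim in the proof of Proposition 3.1.** If the partials of the cubic
`f` are independent and `f` has no nonzero partial derivative of rank `≤ 3`, then for
every 2-dimensional `U ⊂ ℂ⁶` the space `I_Δ(2) ∩ Q_f` has dimension exactly 12. -/
theorem statement10 (f : MvPolynomial (Fin 6) ℂ) (hf : f.IsHomogeneous 3)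
    (hind : LinearIndependent ℂ (fun i : Fin 6 => pderiv i f))
    (hrk : ∀ v : Fin 6 → ℂ, v ≠ 0 → ¬ QuadRankLe (pdir v f) 3) :
    ∀ U : Submodule ℂ (Fin 6 → ℂ), Module.finrank ℂ U = 2 →
      Module.finrank ℂ (Submodule.span ℂ (QfU f U)) = 12 := by
  intro U hU
  have hrk2 : ∀ v : Fin 6 → ℂ, v ≠ 0 → ¬ QuadRankLe (pdir v f) 2 := fun v hv ⟨M, hM, hr, he⟩ =>
    hrk v hv ⟨M, hM, hr.trans (by norm_num), he⟩
  have : FiniteDimensional ℂ U := Module.finite_of_finrank_pos (by rw [hU]; norm_num)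
  let b := Module.finBasisOfFinrankEq ℂ U hU
  have hb : (U.subtype ∘ b) = ![(b 0 : Fin 6 → ℂ), (b 1 : Fin 6 → ℂ)] := by
    ext i : 1
    fin_cases i <;> rfl
  have hli : LinearIndependent ℂ ![(b 0 : Fin 6 → ℂ), (b 1 : Fin 6 → ℂ)] :=
    hb ▸ b.linearIndependent.map' U.subtype U.ker_subtype
  have hspan : U = Submodule.span ℂ {(b 0 : Fin 6 → ℂ), (b 1 : Fin 6 → ℂ)} := by
    rw [← Matrix.range_cons_cons_empty, ← hb, Set.range_comp, ← Submodule.map_span, b.span_eq,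
      Submodule.map_subtype_top]
  rw [hspan]
  exact finrank_span_QfU hf hrk2 hli
end
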